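/- arXiv:1807.08773 — 2 statements merged into one kernel-verified Lean document; each statement's English description precedes it below -/
import Mathlib

section
/- Let p and p' be two different probability distributions on the same finite sample space X, both with rational entries, such that H(p') > H(p) and the number of nonzero entries of p' is at least the number of nonzero entries of p. Then there exists a probability distribution q on some finite sample space Z, a finite dimension d with uniform distribution u_d on a d-element sample space Y, and a permutation P of X × Y × Z such that the marginal on Z of P(p ⊗ u_d ⊗ q) equals q, and the marginal on X × Y of P(p ⊗ u_d ⊗ q) equals p' ⊗ u_d. -/
noncomputable section

/-- `p` is a probability distribution on the finite sample space `ι`. -/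
def IsProbDist {ι : Type*} [Fintype ι] (p : ι → ℝ) : Prop :=
  (∀ x, 0 ≤ p x) ∧ ∑ x, p x = 1

/-- Shannon entropy `H(p) = -∑ₓ p(x) log p(x)` (natural logarithm). -/
def shannon {ι : Type*} [Fintype ι] (p : ι → ℝ) : ℝ :=
  ∑ x, Real.negMulLog (p x)

/-- Sums over tuples split along the entry at a chosen index. -/
theorem sum_eq_sum_insertNth {X : Type*} [Fintype X] {n : ℕ} (k : Fin (n + 1))
    (F : (Fin (n + 1) → X) → ℝ) :
    ∑ s, F s = ∑ x, ∑ w : Fin n → X, F (k.insertNth (α := fun _ => X) x w) := by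
  rw [← Fintype.sum_prod_type']
  exact (Fintype.sum_equiv (Fin.insertNthEquiv (fun _ => X) k) _ _ (fun _ => rfl)).symm

/-- The `n`-fold product distribution. -/
def iid {X : Type*} (p : X → ℝ) (n : ℕ) (s : Fin n → X) : ℝ := ∏ i, p (s i)

theorem iid_nonneg {X : Type*} [Fintype X] {p : X → ℝ} (hp : IsProbDist p) (n : ℕ)
    (s : Fin n → X) : 0 ≤ iid p n s :=
  Finset.prod_nonneg fun _ _ => hp.1 _

theorem sum_iid {X : Type*} [Fintype X] {p : X → ℝ} (hp : IsProbDist p) (n : ℕ) :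
    ∑ s, iid p n s = 1 := by
  classical
  simp only [iid]
  rw [← Fintype.prod_sum (fun (_ : Fin n) x => p x)]
  simp [hp.2]

theorem sum_iid_mul_sq {X : Type*} [Fintype X] {p : X → ℝ} (hp : IsProbDist p) {h : X → ℝ}
    (hh : ∑ x, p x * h x = 0) (n : ℕ) :
    ∑ s, iid p n s * (∑ i, h (s i)) ^ 2 = n * ∑ x, p x * h x ^ 2 := by
  induction n with
  | zero => simp
  | succ n ih =>
    have key : ∀ (x : X) (w : Fin n → X),
        iid p (n + 1) ((0 : Fin (n + 1)).insertNth (α := fun _ => X) x w) *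
          (∑ i, h ((0 : Fin (n + 1)).insertNth (α := fun _ => X) x w i)) ^ 2 =
        p x * h x ^ 2 * iid p n w + p x * h x * (2 * (iid p n w * ∑ i, h (w i))) +
          p x * (iid p n w * (∑ i, h (w i)) ^ 2) := by
      intro x w
      simp only [iid]
      rw [Fin.prod_univ_succAbove _ 0, Fin.sum_univ_succAbove _ 0]
      simp only [Fin.insertNth_apply_same, Fin.insertNth_apply_succAbove]
      ring
    rw [sum_eq_sum_insertNth 0]
    simp only [key, Finset.sum_add_distrib, ← Finset.mul_sum, ← Finset.sum_mul, sum_iid hp, ih, hh,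
      hp.2]
    push_cast
    ring

/-- Chebyshev's inequality for sums of independent copies. -/
theorem sum_iid_filter_le {X : Type*} [Fintype X] {p : X → ℝ} (hp : IsProbDist p) {h : X → ℝ}
    (hh : ∑ x, p x * h x = 0) {δ : ℝ} (hδ : 0 < δ) {n : ℕ} (hn : 0 < n) :
    ∑ s with n * δ ≤ |∑ i, h (s i)|, iid p n s ≤ (∑ x, p x * h x ^ 2) / δ ^ 2 / n := by
  have hn' : (0 : ℝ) < n := by exact_mod_cast hn
  have h1 : (n * δ) ^ 2 * ∑ s with n * δ ≤ |∑ i, h (s i)|, iid p n s ≤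
      n * ∑ x, p x * h x ^ 2 := by
    rw [← sum_iid_mul_sq hp hh, Finset.mul_sum]
    refine (Finset.sum_le_sum fun s hs => ?_).trans
      (Finset.sum_le_sum_of_subset_of_nonneg (Finset.subset_univ _) fun s _ _ =>
        mul_nonneg (iid_nonneg hp n s) (sq_nonneg _))
    rw [Finset.mem_filter] at hs
    rw [mul_comm, ← sq_abs (∑ i, h (s i))]
    have := iid_nonneg hp n s
    have := hs.2
    gcongr
  rw [div_div, le_div_iff₀ (by positivity)]
  refine le_of_mul_le_mul_left (a := (n : ℝ)) ?_ hn'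
  linarith

/-- The weak law of large numbers. -/
theorem eventually_sum_iid_filter_le {X : Type*} [Fintype X] {p : X → ℝ} (hp : IsProbDist p)
    (f : X → ℝ) {δ ε : ℝ} (hδ : 0 < δ) (hε : 0 < ε) :
    ∀ᶠ n : ℕ in Filter.atTop,
      ∑ s with n * δ ≤ |∑ i, f (s i) - n * ∑ x, p x * f x|, iid p n s ≤ ε := by
  set m := ∑ x, p x * f x with hm
  have hh : ∑ x, p x * (f x - m) = 0 := by
    simp only [mul_sub, Finset.sum_sub_distrib, ← Finset.sum_mul, hp.2]
    rw [← hm]; ring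
  have ht := tendsto_const_div_atTop_nhds_zero_nat ((∑ x, p x * (f x - m) ^ 2) / δ ^ 2)
  filter_upwards [ht.eventually_le_const hε, Filter.eventually_gt_atTop 0] with n hn hn0
  refine le_trans ?_ ((sum_iid_filter_le hp hh hδ hn0).trans hn)
  simp [Finset.sum_sub_distrib]

theorem log_iid {X : Type*} {p : X → ℝ} {n : ℕ} {s : Fin n → X} (h : iid p n s ≠ 0) :
    ∑ i, -Real.log (p (s i)) = -Real.log (iid p n s) := by
  rw [iid, Real.log_prod fun i _ => (Finset.prod_ne_zero_iff.1 h) i (Finset.mem_univ i)]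
  simp

theorem sum_mul_neg_log {X : Type*} [Fintype X] (p : X → ℝ) :
    ∑ x, p x * -Real.log (p x) = shannon p := by
  simp [shannon, Real.negMulLog]

theorem eventually_exists_typical {X : Type*} [Fintype X] {p : X → ℝ} (hp : IsProbDist p)
    {a ε : ℝ} (ha : shannon p < a) (hε : 0 < ε) :
    ∀ᶠ n : ℕ in Filter.atTop, ∃ A : Finset (Fin n → X),
      (A.card : ℝ) ≤ Real.exp (n * a) ∧ 1 - ε ≤ ∑ s ∈ A, iid p n s := by
  filter_upwards [eventually_sum_iid_filter_le hp (fun x => -Real.log (p x)) (sub_pos.2 ha) hε]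
    with n hn
  refine ⟨Finset.univ.filter fun s => Real.exp (-(n * a)) ≤ iid p n s, ?_, ?_⟩
  · set A := Finset.univ.filter fun s => Real.exp (-(n * a)) ≤ iid p n s
    have h1 : A.card * Real.exp (-(n * a)) ≤ 1 := by
      rw [← nsmul_eq_mul, ← sum_iid hp n]
      refine (Finset.card_nsmul_le_sum A _ _ fun s hs => (Finset.mem_filter.1 hs).2).trans ?_
      exact Finset.sum_le_sum_of_subset_of_nonneg (Finset.subset_univ _) fun s _ _ =>
        iid_nonneg hp n s
    rwa [Real.exp_neg, ← div_eq_mul_inv, div_le_one (Real.exp_pos _)] at h1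
  · rw [← sum_iid hp n,
      ← Finset.sum_filter_add_sum_filter_not Finset.univ
        (fun s => Real.exp (-(n * a)) ≤ iid p n s) (iid p n)]
    suffices ∑ s with ¬ Real.exp (-(n * a)) ≤ iid p n s, iid p n s ≤ ε by linarith
    refine le_trans ?_ hn
    rw [sum_mul_neg_log, Finset.sum_filter, Finset.sum_filter]
    refine Finset.sum_le_sum fun s _ => ?_
    have h0 := iid_nonneg hp n s
    rcases h0.eq_or_lt with h0 | h0
    · simp [← h0]
    · by_cases h : Real.exp (-(n * a)) ≤ iid p n s
      · rw [if_neg (not_not.2 h)]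
        split_ifs <;> simp [h0.le]
      · rw [if_pos h, if_pos]
        rw [log_iid h0.ne']
        rw [not_le, ← Real.log_lt_iff_lt_exp h0] at h
        refine le_trans ?_ (le_abs_self _)
        linarith

/-- The fraction of entries of `s` equal to `x`. -/
def freq {X : Type*} [DecidableEq X] {n : ℕ} (x : X) (s : Fin n → X) : ℝ :=
  (∑ i, if s i = x then 1 else 0) / n

theorem freq_nonneg {X : Type*} [DecidableEq X] {n : ℕ} (x : X) (s : Fin n → X) :
    0 ≤ freq x s :=
  div_nonneg (Finset.sum_nonneg fun i _ => by split_ifs <;> simp) n.cast_nonneg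

theorem freq_le_one {X : Type*} [DecidableEq X] {n : ℕ} (x : X) (s : Fin n → X) :
    freq x s ≤ 1 := by
  refine div_le_one_of_le₀ ?_ n.cast_nonneg
  refine (Finset.sum_le_card_nsmul _ _ 1 fun i _ => ?_).trans (by simp)
  split_ifs <;> simp

theorem sum_freq {X : Type*} [Fintype X] [DecidableEq X] {n : ℕ} (hn : 0 < n) (s : Fin n → X) :
    ∑ x, freq x s = 1 := by
  have : (n : ℝ) ≠ 0 := by exact_mod_cast hn.ne'
  simp only [freq, ← Finset.sum_div]
  rw [Finset.sum_comm]
  simp [this]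

theorem eventually_card_freq_near {X : Type*} [Fintype X] [DecidableEq X] {t : X → ℝ}
    (ht : IsProbDist t) {a ε : ℝ} (ha : a < shannon t) (hε : 0 < ε) :
    ∀ᶠ n : ℕ in Filter.atTop, Real.exp (n * a) ≤
      ((Finset.univ.filter fun s : Fin n → X => ∀ x, |freq x s - t x| ≤ ε).card : ℝ) := by
  obtain ⟨b, hab, hb⟩ := exists_between ha
  obtain ⟨κ, hκ, hκX⟩ : ∃ κ : ℝ, 0 < κ ∧ Fintype.card X * κ ≤ 1 / 4 := by
    refine ⟨1 / (4 * (Fintype.card X + 1)), by positivity, ?_⟩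
    rw [mul_one_div, div_le_div_iff₀ (by positivity) (by norm_num)]
    linarith
  have hfreq : ∀ x, ∀ᶠ n : ℕ in Filter.atTop,
      ∑ s : Fin n → X with ε < |freq x s - t x|, iid t n s ≤ κ := by
    intro x
    filter_upwards [eventually_sum_iid_filter_le ht (fun y => if y = x then 1 else 0) hε hκ,
      Filter.eventually_gt_atTop 0] with n hn hn0
    have hn' : (0 : ℝ) < n := by exact_mod_cast hn0
    refine le_trans (Finset.sum_le_sum_of_subset_of_nonneg ?_ fun s _ _ => iid_nonneg ht n s) hn
    intro s hs
    simp only [Finset.mem_filter, Finset.mem_univ, true_and] at hs ⊢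
    have : (∑ i, if s i = x then (1 : ℝ) else 0) = n * freq x s := by
      rw [freq]; field_simp
    rw [this]
    simp only [mul_ite, mul_one, mul_zero, Finset.sum_ite_eq', Finset.mem_univ, if_true]
    rw [← mul_sub, abs_mul, abs_of_pos hn']
    gcongr
  have hexp : ∀ᶠ n : ℕ in Filter.atTop, Real.log 2 ≤ n * (b - a) :=
    (tendsto_natCast_atTop_atTop.atTop_mul_const (sub_pos.2 hab)).eventually_ge_atTop _
  filter_upwards [Filter.eventually_all.2 hfreq, hexp,
    eventually_sum_iid_filter_le ht (fun x => -Real.log (t x)) (sub_pos.2 hb)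
      (by norm_num : (0 : ℝ) < 1 / 4)] with n h1 h2 h3
  rw [sum_mul_neg_log] at h3
  set B := Finset.univ.filter fun s : Fin n → X => ∀ x, |freq x s - t x| ≤ ε with hB
  set T := Finset.univ.filter fun s : Fin n → X =>
    n * (shannon t - b) ≤ |∑ i, -Real.log (t (s i)) - n * shannon t|
  have hnn := iid_nonneg ht n
  have hcover : ∀ s : Fin n → X, iid t n s ≤
      (∑ x, if ε < |freq x s - t x| then iid t n s else 0) + (if s ∈ T then iid t n s else 0) +
        (if s ∈ B \ T then iid t n s else 0) := by
    intro s
    have h0 : ∀ x ∈ Finset.univ, 0 ≤ if ε < |freq x s - t x| then iid t n s else 0 :=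
      fun x _ => ite_nonneg (hnn s) le_rfl
    have h0' := Finset.sum_nonneg h0
    by_cases hsT : s ∈ T
    · simp only [hsT, Finset.mem_sdiff, if_true, not_true, and_false, if_false]
      linarith
    by_cases hsB : s ∈ B
    · simp only [hsT, hsB, Finset.mem_sdiff, if_true, not_false_eq_true, and_true, if_false]
      linarith
    · obtain ⟨x, hx⟩ : ∃ x, ε < |freq x s - t x| := by simpa [hB] using hsB
      have := Finset.single_le_sum h0 (Finset.mem_univ x)
      simp only [hsT, hsB, Finset.mem_sdiff, if_false, false_and]
      rw [if_pos hx] at this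
      linarith
  have hmass : 1 / 2 ≤ ∑ s ∈ B \ T, iid t n s := by
    have hsum := Finset.sum_le_sum fun s (_ : s ∈ Finset.univ) => hcover s
    rw [sum_iid ht, Finset.sum_add_distrib, Finset.sum_add_distrib, Finset.sum_comm] at hsum
    simp only [← Finset.sum_filter, Finset.filter_univ_mem] at hsum
    have hdev := (Finset.sum_le_card_nsmul Finset.univ _ κ fun x _ => h1 x)
    rw [nsmul_eq_mul, Finset.card_univ] at hdev
    linarith
  have hle : ∀ s ∈ B \ T, iid t n s ≤ Real.exp (-(n * b)) := by
    intro s hs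
    by_contra! hlt
    have h0 := (Real.exp_pos _).trans hlt
    refine (Finset.mem_sdiff.1 hs).2 (Finset.mem_filter.2 ⟨Finset.mem_univ _, ?_⟩)
    rw [log_iid h0.ne', abs_sub_comm]
    rw [← Real.lt_log_iff_exp_lt h0] at hlt
    refine le_trans ?_ (le_abs_self _)
    linarith
  have hcard : 1 / 2 ≤ (B.card : ℝ) * Real.exp (-(n * b)) := by
    refine hmass.trans ((Finset.sum_le_card_nsmul _ _ _ hle).trans ?_)
    rw [nsmul_eq_mul]
    gcongr
    exact Finset.sdiff_subset
  have hexp2 : 2 * Real.exp (n * a) ≤ Real.exp (n * b) := by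
    have := Real.exp_le_exp.2 (show Real.log 2 + n * a ≤ n * b by linarith)
    rwa [Real.exp_add, Real.exp_log two_pos] at this
  rw [Real.exp_neg, ← div_eq_mul_inv, le_div_iff₀ (Real.exp_pos _)] at hcard
  linarith

/-- If `H(p) < H(t)`, some permutation of `n`-tuples brings the averaged one-site marginals of
`p^{⊗n}` close to `t`. -/
theorem eventually_exists_perm_freq_near {X : Type*} [Fintype X] [DecidableEq X] {p t : X → ℝ}
    (hp : IsProbDist p) (ht : IsProbDist t) (hH : shannon p < shannon t) {ε : ℝ} (hε : 0 < ε) :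
    ∀ᶠ n : ℕ in Filter.atTop, ∃ σ : Equiv.Perm (Fin n → X), ∀ x,
      |∑ s, iid p n s * freq x (σ s) - t x| ≤ ε := by
  obtain ⟨a, hpa, hat⟩ := exists_between hH
  filter_upwards [eventually_exists_typical hp hpa (half_pos hε),
    eventually_card_freq_near ht hat (half_pos hε)] with n ⟨A, hA, hmass⟩ hB
  set B := Finset.univ.filter fun s : Fin n → X => ∀ x, |freq x s - t x| ≤ ε / 2
  have hAB : A.card ≤ B.card := by exact_mod_cast hA.trans hB
  obtain ⟨σ, hσ⟩ : ∃ σ : Equiv.Perm (Fin n → X), ∀ s ∈ A, σ s ∈ B := by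
    obtain ⟨C, hCB, hC⟩ := Finset.exists_subset_card_eq hAB
    let e : {s // s ∈ A} ≃ {s // s ∈ C} := Finset.equivOfCardEq hC.symm
    refine ⟨e.extendSubtype, fun s hs => hCB ?_⟩
    exact e.extendSubtype_mem s hs
  refine ⟨σ, fun x => ?_⟩
  have hnn := iid_nonneg hp n
  have htx : t x ≤ 1 := by
    rw [← ht.2]
    exact Finset.single_le_sum (fun i _ => ht.1 i) (Finset.mem_univ x)
  have h1 : ∑ s, iid p n s * freq x (σ s) - t x = ∑ s, iid p n s * (freq x (σ s) - t x) := by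
    simp only [mul_sub, Finset.sum_sub_distrib, ← Finset.sum_mul, sum_iid hp, one_mul]
  have hsplit := Finset.sum_add_sum_compl A (iid p n)
  rw [sum_iid hp] at hsplit
  have hA1 : ∑ s ∈ A, iid p n s ≤ 1 := by
    linarith [Finset.sum_nonneg (s := Aᶜ) fun s _ => hnn s]
  calc |∑ s, iid p n s * freq x (σ s) - t x|
      ≤ ∑ s, iid p n s * |freq x (σ s) - t x| := by
        rw [h1]
        refine (Finset.abs_sum_le_sum_abs _ _).trans (Finset.sum_le_sum fun s _ => ?_)
        rw [abs_mul, abs_of_nonneg (hnn s)]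
    _ = ∑ s ∈ A, iid p n s * |freq x (σ s) - t x| +
          ∑ s ∈ Aᶜ, iid p n s * |freq x (σ s) - t x| := (Finset.sum_add_sum_compl A _).symm
    _ ≤ ∑ s ∈ A, iid p n s * (ε / 2) + ∑ s ∈ Aᶜ, iid p n s * 1 := by
        gcongr with s hs s hs
        · exact hnn s
        · exact (Finset.mem_filter.1 (hσ s hs)).2 x
        · exact hnn s
        · rw [abs_le]
          constructor <;> linarith [freq_nonneg x (σ s), freq_le_one x (σ s), ht.1 x]
    _ ≤ ε := by
        rw [← Finset.sum_mul, ← Finset.sum_mul]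
        nlinarith

theorem exists_fin_map_sum_eq {X : Type*} [Fintype X] (w : X → ℚ) (hw : ∀ x, 0 ≤ w x)
    (hw1 : ∑ x, w x = 1) :
    ∃ (d : ℕ) (g : Fin d → X), 0 < d ∧
      ∀ F : X → ℝ, ∑ c, F (g c) = d * ∑ x, (w x : ℝ) * F x := by
  classical
  set d := ∏ x, (w x).den with hd
  have hd0 : 0 < d := Finset.prod_pos fun x _ => (w x).den_pos
  have hm : ∀ x, ∃ m : ℕ, (m : ℚ) = d * w x := by
    intro x
    refine ⟨(∏ y ∈ Finset.univ.erase x, (w y).den) * (w x).num.toNat, ?_⟩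
    have h1 : (((w x).num.toNat : ℤ) : ℚ) = w x * (w x).den := by
      rw [Int.toNat_of_nonneg (Rat.num_nonneg.2 (hw x)), Rat.mul_den_eq_num]
    rw [hd, ← Finset.prod_erase_mul _ _ (Finset.mem_univ x)]
    push_cast at h1 ⊢
    rw [h1]; ring
  choose m hm using hm
  have hcard : Fintype.card (Σ x, Fin (m x)) = d := by
    have : ((∑ x, m x : ℕ) : ℚ) = d := by
      push_cast
      simp only [hm, ← Finset.mul_sum, hw1, mul_one]
    simpa using (by exact_mod_cast this : ∑ x, m x = d)
  let e := Fintype.equivFinOfCardEq hcard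
  refine ⟨d, fun c => (e.symm c).1, hd0, fun F => ?_⟩
  rw [Equiv.sum_comp e.symm (fun c : Σ x, Fin (m x) => F c.1), Fintype.sum_sigma, Finset.mul_sum]
  refine Finset.sum_congr rfl fun x _ => ?_
  have : (m x : ℝ) = d * (w x : ℝ) := by exact_mod_cast congrArg (Rat.cast (K := ℝ)) (hm x)
  simp [this, mul_assoc]

/-- If the columns of a rational matrix are close to the vertices `(1 - η) p' + η δ_x` of a simplex
around `p'`, then `p'` is a rational convex combination of the columns. -/
theorem exists_rat_convex_combination {X : Type*} [Fintype X] [DecidableEq X] {p' : X → ℝ}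
    (hp' : IsProbDist p') (hrat' : ∀ x, ∃ r : ℚ, p' x = r) {η ε : ℝ} (hη : 0 < η) (hε : 0 ≤ ε)
    (hcard : 2 * Fintype.card X * ε ≤ η) (hεp : ∀ x, 2 * ε ≤ η * p' x)
    (M : Matrix X X ℚ) (hcol : ∀ x, ∑ y, M y x = 1)
    (hM : ∀ x y, |(M y x : ℝ) - ((1 - η) * p' y + η * if x = y then 1 else 0)| ≤ ε) :
    ∃ w : X → ℚ, (∀ x, 0 ≤ w x) ∧ ∑ x, w x = 1 ∧
      ∀ y, ∑ x, (w x : ℝ) * (M y x : ℝ) = p' y := by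
  choose r hr using hrat'
  have hsum : ∀ (v : X → ℚ), ∑ y, (M.mulVec v) y = ∑ x, v x := by
    intro v
    simp only [Matrix.mulVec, dotProduct]
    rw [Finset.sum_comm]
    simp only [← Finset.sum_mul, hcol, one_mul]
  have hr1 : ∑ x, r x = 1 := by
    have := hp'.2
    simp only [hr] at this
    exact_mod_cast this
  have hdiff : ∀ (v : X → ℚ) (c : ℚ), M.mulVec v = c • r → ∑ x, v x = c ∧
      ∀ y, η * |(v y : ℝ) - c * p' y| ≤ ε * ∑ x, |(v x : ℝ)| := by
    intro v c hv
    have hvc : ∑ x, v x = c := by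
      rw [← hsum, hv]
      simp [← Finset.mul_sum, hr1]
    refine ⟨hvc, fun y => ?_⟩
    have hvc' : ∑ x, (v x : ℝ) = c := by exact_mod_cast congrArg (Rat.cast (K := ℝ)) hvc
    have hvy : ∑ x, (M y x : ℝ) * v x = c * p' y := by
      have := congrFun hv y
      simp only [Matrix.mulVec, dotProduct, Pi.smul_apply, smul_eq_mul] at this
      rw [hr]
      exact_mod_cast congrArg (Rat.cast (K := ℝ)) this
    have hid : η * ((v y : ℝ) - c * p' y) =
        -∑ x, ((M y x : ℝ) - ((1 - η) * p' y + η * if x = y then 1 else 0)) * v x := by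
      simp only [sub_mul, add_mul, Finset.sum_sub_distrib, Finset.sum_add_distrib, hvy,
        ← Finset.mul_sum, hvc', mul_ite, mul_one, mul_zero, ite_mul, zero_mul,
        Finset.sum_ite_eq', Finset.mem_univ, if_true]
      ring
    have habs := abs_mul η ((v y : ℝ) - c * p' y)
    rw [abs_of_pos hη] at habs
    rw [← habs, hid, abs_neg, Finset.mul_sum]
    refine (Finset.abs_sum_le_sum_abs _ _).trans (Finset.sum_le_sum fun x _ => ?_)
    rw [abs_mul]
    gcongr
    exact hM x y
  have hnorm : ∀ (v : X → ℚ) (c : ℚ), M.mulVec v = c • r → ∑ x, |(v x : ℝ)| ≤ 2 * |(c : ℝ)| := by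
    intro v c hv
    set N := ∑ x, |(v x : ℝ)| with hN
    have h1 : η * ∑ y, |(v y : ℝ) - c * p' y| ≤ Fintype.card X * (ε * N) := by
      rw [Finset.mul_sum, ← nsmul_eq_mul]
      exact Finset.sum_le_card_nsmul _ _ _ fun y _ => (hdiff v c hv).2 y
    have h2 : N ≤ ∑ y, |(v y : ℝ) - c * p' y| + |(c : ℝ)| := by
      have : |(c : ℝ)| = ∑ y, |(c : ℝ) * p' y| := by
        simp only [abs_mul, ← Finset.mul_sum]
        simp [abs_of_nonneg (hp'.1 _), hp'.2]
      rw [this, hN, ← Finset.sum_add_distrib]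
      refine Finset.sum_le_sum fun y _ => ?_
      simpa using abs_add_le ((v y : ℝ) - c * p' y) (c * p' y)
    have hN0 : 0 ≤ N := Finset.sum_nonneg fun _ _ => abs_nonneg _
    have h3 := mul_le_mul_of_nonneg_right hcard hN0
    have h4 := mul_le_mul_of_nonneg_left h2 hη.le
    refine le_of_mul_le_mul_left (a := η) ?_ hη
    linarith
  have hinj : Function.Injective M.mulVecLin := by
    rw [← LinearMap.ker_eq_bot, LinearMap.ker_eq_bot']
    intro v hv
    have h := hnorm v 0 (by simpa using hv)
    ext x
    have h1 := Finset.single_le_sum (f := fun x => |(v x : ℝ)|) (fun _ _ => abs_nonneg _)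
      (Finset.mem_univ x)
    have h2 : |(v x : ℝ)| ≤ 0 := by simpa using h1.trans h
    simpa using h2
  obtain ⟨w, hw⟩ := LinearMap.injective_iff_surjective.1 hinj r
  rw [Matrix.mulVecLin_apply] at hw
  have hw' : M.mulVec w = (1 : ℚ) • r := by rw [hw, one_smul]
  refine ⟨w, fun x => ?_, (hdiff w 1 hw').1, fun y => ?_⟩
  · have h1 := (hdiff w 1 hw').2 x
    have h2 := hnorm w 1 hw'
    simp only [Rat.cast_one, one_mul, abs_one, mul_one] at h1 h2
    have h3 := mul_le_mul_of_nonneg_left h2 hε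
    have h4 := mul_le_mul_of_nonneg_left (neg_abs_le ((w x : ℝ) - p' x)) hη.le
    have h5 : 0 ≤ η * (w x : ℝ) := by linarith [hεp x]
    exact_mod_cast nonneg_of_mul_nonneg_right h5 hη
  · have := congrFun hw y
    simp only [Matrix.mulVec, dotProduct] at this
    rw [hr, ← this]
    push_cast
    exact Finset.sum_congr rfl fun x _ => mul_comm _ _

theorem exists_rat_sum_iid_mul_freq {X : Type*} [Fintype X] [DecidableEq X] {p : X → ℝ}
    (hrat : ∀ x, ∃ r : ℚ, p x = r) {n : ℕ} (σ : Equiv.Perm (Fin n → X)) (x : X) :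
    ∃ r : ℚ, (r : ℝ) = ∑ s, iid p n s * freq x (σ s) := by
  change ∑ s, iid p n s * freq x (σ s) ∈ (Rat.castHom ℝ).fieldRange
  refine sum_mem fun s _ => mul_mem (prod_mem fun i _ => ?_)
    (div_mem (sum_mem fun i _ => ?_) (natCast_mem _ n))
  · obtain ⟨r, hr⟩ := hrat (s i)
    exact ⟨r, hr.symm⟩
  · split_ifs
    · exact one_mem _
    · exact zero_mem _

/-- Rational mixtures of permutations of `p^{⊗n}` reach averaged one-site marginals exactly
equal to `p'`. -/
theorem exists_perms_average_freq_eq {X : Type*} [Fintype X] [DecidableEq X] {p p' : X → ℝ}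
    (hp : IsProbDist p) (hp' : IsProbDist p') (hrat : ∀ x, ∃ r : ℚ, p x = r)
    (hrat' : ∀ x, ∃ r : ℚ, p' x = r) (hpos : ∀ x, 0 < p' x) (hH : shannon p < shannon p') :
    ∃ (n d : ℕ) (σ : Fin d → Equiv.Perm (Fin (n + 1) → X)), 0 < d ∧
      ∀ x, ∑ c, ∑ s, iid p (n + 1) s * freq x (σ c s) = d * p' x := by
  let t : X → ℝ → X → ℝ := fun x η y => (1 - η) * p' y + η * if x = y then 1 else 0
  have ht : ∀ x η, 0 < η → η < 1 → IsProbDist (t x η) := by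
    intro x η h0 h1
    refine ⟨fun y => ?_, ?_⟩
    · have := hp'.1 y
      have : 0 ≤ 1 - η := by linarith
      dsimp only [t]
      split_ifs <;> positivity
    · simp [t, Finset.sum_add_distrib, ← Finset.mul_sum, hp'.2]
  have hcont : ∀ x, ∀ᶠ η in nhdsWithin (0 : ℝ) (Set.Ioi 0), shannon p < shannon (t x η) := by
    intro x
    have hc : Continuous fun η => shannon (t x η) := by
      unfold shannon
      exact continuous_finsetSum _ fun y _ => Real.continuous_negMulLog.comp (by fun_prop)
    have h0 : shannon (t x 0) = shannon p' := by simp [t]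
    refine (hc.tendsto 0).mono_left nhdsWithin_le_nhds |>.eventually_const_lt ?_
    rwa [h0]
  obtain ⟨η, hη, hη0, hη1⟩ := ((Filter.eventually_all.2 hcont).and
    (Ioo_mem_nhdsGT (zero_lt_one' ℝ))).exists
  obtain ⟨ε, hε, hεcard, hεp⟩ : ∃ ε : ℝ, 0 < ε ∧ 2 * Fintype.card X * ε ≤ η ∧
      ∀ x, 2 * ε ≤ η * p' x := by
    have h1 : ∀ᶠ ε in nhdsWithin (0 : ℝ) (Set.Ioi 0), 2 * Fintype.card X * ε < η := by
      have hc : Continuous fun ε : ℝ => 2 * Fintype.card X * ε := by fun_prop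
      refine (hc.tendsto 0).mono_left nhdsWithin_le_nhds |>.eventually_lt_const ?_
      simpa using hη0
    have h2 : ∀ x, ∀ᶠ ε in nhdsWithin (0 : ℝ) (Set.Ioi 0), 2 * ε < η * p' x := by
      intro x
      have hc : Continuous fun ε : ℝ => 2 * ε := by fun_prop
      refine (hc.tendsto 0).mono_left nhdsWithin_le_nhds |>.eventually_lt_const ?_
      simpa using mul_pos hη0 (hpos x)
    obtain ⟨ε, h, h1, h2⟩ := (eventually_mem_nhdsWithin.and
      (h1.and (Filter.eventually_all.2 h2))).exists
    exact ⟨ε, h, h1.le, fun x => (h2 x).le⟩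
  obtain ⟨n, hn, hn0⟩ := ((Filter.eventually_all.2 fun x =>
    eventually_exists_perm_freq_near hp (ht x η hη0 hη1) (hη x) hε).and
    (Filter.eventually_gt_atTop 0)).exists
  choose π hπ using hn
  choose M hM using fun x y => exists_rat_sum_iid_mul_freq hrat (π x) y
  have hcol : ∀ x, ∑ y, M x y = 1 := by
    intro x
    have : ∑ y, (M x y : ℝ) = 1 := by
      simp only [hM]
      rw [Finset.sum_comm]
      simp only [← Finset.mul_sum, sum_freq hn0, mul_one, sum_iid hp]
    exact_mod_cast this
  obtain ⟨w, hw0, hw1, hw⟩ := exists_rat_convex_combination hp' hrat' hη0 hε.le hεcard hεp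
    (Matrix.of fun y x => M x y) hcol fun x y => by
      rw [Matrix.of_apply, hM]; exact hπ x y
  obtain ⟨d, g, hd, hg⟩ := exists_fin_map_sum_eq w hw0 hw1
  obtain ⟨n, rfl⟩ := Nat.exists_eq_succ_of_ne_zero hn0.ne'
  refine ⟨n, d, fun c => π (g c), hd, fun x => ?_⟩
  rw [hg fun y => ∑ s, iid p (n + 1) s * freq x (π y s), ← hw x]
  simp only [Matrix.of_apply, hM]

/-- The first `j` entries are independent with law `p`, the others follow `r`. -/
def hybrid {X : Type*} [Fintype X] [DecidableEq X] {n : ℕ} (p : X → ℝ) (r : (Fin n → X) → ℝ)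
    (j : ℕ) (s : Fin n → X) : ℝ :=
  ∑ s', r s' * ∏ i : Fin n, if (i : ℕ) < j then p (s i) else if s i = s' i then 1 else 0

/-- The marginal of `hybrid p r k` on all entries but the `k`-th. -/
def hybridRest {X : Type*} [Fintype X] [DecidableEq X] {n : ℕ} (p : X → ℝ)
    (r : (Fin (n + 1) → X) → ℝ) (k : Fin (n + 1)) (w : Fin n → X) : ℝ :=
  ∑ s', r s' * ∏ i : Fin n,
    if (k.succAbove i : ℕ) < k then p (w i) else if w i = s' (k.succAbove i) then 1 else 0

section Hybrid

variable {X : Type*} [Fintype X] [DecidableEq X] {n : ℕ} (p : X → ℝ)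

theorem hybrid_zero (r : (Fin n → X) → ℝ) (s : Fin n → X) : hybrid p r 0 s = r s := by
  have : ∀ s', (∏ i : Fin n, if s i = s' i then (1 : ℝ) else 0) = if s = s' then 1 else 0 := by
    intro s'
    rw [Fintype.prod_boole]
    split_ifs <;> simp_all [funext_iff]
  simp [hybrid, this]

theorem hybrid_length {r : (Fin n → X) → ℝ} (hr : ∑ s, r s = 1) (s : Fin n → X) :
    hybrid p r n s = iid p n s := by
  simp [hybrid, iid, ← Finset.sum_mul, hr]

theorem hybrid_succ_insertNth (r : (Fin (n + 1) → X) → ℝ) (k : Fin (n + 1)) (x : X)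
    (w : Fin n → X) :
    hybrid p r (k + 1) (k.insertNth (α := fun _ => X) x w) = p x * hybridRest p r k w := by
  rw [hybrid, hybridRest, Finset.mul_sum]
  refine Finset.sum_congr rfl fun s' _ => ?_
  have hlt : ∀ i : Fin n, (k.succAbove i : ℕ) < k + 1 ↔ (k.succAbove i : ℕ) < k := by
    intro i
    have := Fin.val_ne_of_ne (Fin.succAbove_ne k i)
    omega
  rw [Fin.prod_univ_succAbove _ k]
  simp only [Fin.insertNth_apply_same, Fin.insertNth_apply_succAbove, hlt, Nat.lt_succ_self,
    if_true]
  ring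

theorem hybrid_insertNth (r : (Fin (n + 1) → X) → ℝ) (k : Fin (n + 1)) (x : X) (w : Fin n → X) :
    hybrid p r k (k.insertNth (α := fun _ => X) x w) =
      ∑ s', r s' * ((if x = s' k then 1 else 0) * ∏ i : Fin n,
        if (k.succAbove i : ℕ) < k then p (w i)
        else if w i = s' (k.succAbove i) then 1 else 0) := by
  rw [hybrid]
  refine Finset.sum_congr rfl fun s' _ => ?_
  rw [Fin.prod_univ_succAbove _ k]
  simp only [Fin.insertNth_apply_same, Fin.insertNth_apply_succAbove, lt_irrefl, if_false]

theorem sum_hybrid_insertNth (r : (Fin (n + 1) → X) → ℝ) (k : Fin (n + 1)) (w : Fin n → X) :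
    ∑ x, hybrid p r k (k.insertNth (α := fun _ => X) x w) = hybridRest p r k w := by
  simp only [hybrid_insertNth]
  rw [Finset.sum_comm, hybridRest]
  simp

variable {p}

theorem hybridRest_nonneg (hp : IsProbDist p) {r : (Fin (n + 1) → X) → ℝ} (hr : ∀ s, 0 ≤ r s)
    (k : Fin (n + 1)) (w : Fin n → X) : 0 ≤ hybridRest p r k w := by
  refine Finset.sum_nonneg fun s _ => mul_nonneg (hr s) (Finset.prod_nonneg fun i _ => ?_)
  split_ifs
  exacts [hp.1 _, zero_le_one, le_rfl]

theorem sum_prod_hybrid (hp : IsProbDist p) (k : Fin (n + 1)) (s' : Fin (n + 1) → X) :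
    ∑ w : Fin n → X, ∏ i : Fin n, (if (k.succAbove i : ℕ) < k then p (w i)
      else if w i = s' (k.succAbove i) then 1 else 0) = 1 := by
  rw [← Fintype.prod_sum (fun (i : Fin n) x => if (k.succAbove i : ℕ) < k then p x
      else if x = s' (k.succAbove i) then 1 else 0)]
  refine Finset.prod_eq_one fun i _ => ?_
  split_ifs
  · exact hp.2
  · simp

theorem sum_hybridRest (hp : IsProbDist p) (r : (Fin (n + 1) → X) → ℝ) (k : Fin (n + 1)) :
    ∑ w, hybridRest p r k w = ∑ s, r s := by
  simp only [hybridRest]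
  rw [Finset.sum_comm]
  simp only [← Finset.mul_sum, sum_prod_hybrid hp, mul_one]

theorem sum_hybrid_insertNth_rest (hp : IsProbDist p) (r : (Fin (n + 1) → X) → ℝ)
    (k : Fin (n + 1)) (x : X) :
    ∑ w : Fin n → X, hybrid p r k (k.insertNth (α := fun _ => X) x w) =
      ∑ s, r s * if s k = x then 1 else 0 := by
  simp only [hybrid_insertNth]
  rw [Finset.sum_comm]
  simp only [← Finset.mul_sum, sum_prod_hybrid hp, mul_one, eq_comm]

end Hybrid

universe u

/-- `p` can be converted to `p'` by a uniform mixture of `d` bijections `X × Z ≃ X' × Z`, with the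
help of a catalyst `q` on `Z` which is returned, possibly correlated. -/
def CatalyticallyConvertible {X X' : Type u} [Fintype X] [Fintype X'] (p : X → ℝ)
    (p' : X' → ℝ) : Prop :=
  ∃ (Z : Type u) (_ : Fintype Z) (d : ℕ) (q : Z → ℝ) (π : Fin d → X × Z ≃ X' × Z),
    0 < d ∧ IsProbDist q ∧
    (∀ z, ∑ c, ∑ x, p ((π c).symm (x, z)).1 * q ((π c).symm (x, z)).2 = d * q z) ∧
    ∀ x, ∑ c, ∑ z, p ((π c).symm (x, z)).1 * q ((π c).symm (x, z)).2 = d * p' x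

namespace CatalyticallyConvertible

theorem comp_equiv {X X' A A' : Type u} [Fintype X] [Fintype X'] [Fintype A] [Fintype A']
    {p : X → ℝ} {p' : X' → ℝ} (h : CatalyticallyConvertible p p') (e : A ≃ X) (e' : A' ≃ X') :
    CatalyticallyConvertible (p ∘ e) (p' ∘ e') := by
  obtain ⟨Z, _, d, q, π, hd, hq, hz, hx⟩ := h
  refine ⟨Z, _, d, q, fun c => (e.prodCongr (Equiv.refl Z)).trans
    ((π c).trans (e'.symm.prodCongr (Equiv.refl Z))), hd, hq, fun z => ?_, fun x => ?_⟩
  · rw [← hz z]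
    refine Finset.sum_congr rfl fun c _ => ?_
    rw [← Equiv.sum_comp e']
    simp
  · rw [Function.comp_apply, ← hx]
    simp

theorem sumElim_zero {X X' W : Type u} [Fintype X] [Fintype X'] [Fintype W]
    {p : X → ℝ} {p' : X' → ℝ} (h : CatalyticallyConvertible p p') :
    CatalyticallyConvertible (Sum.elim p (0 : W → ℝ)) (Sum.elim p' (0 : W → ℝ)) := by
  obtain ⟨Z, _, d, q, π, hd, hq, hz, hx⟩ := h
  refine ⟨Z, _, d, q, fun c => (Equiv.sumProdDistrib X W Z).trans
    (((π c).sumCongr (Equiv.refl _)).trans (Equiv.sumProdDistrib X' W Z).symm), hd, hq,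
    fun z => ?_, ?_⟩
  · rw [← hz z]
    simp
  · rintro (x | w)
    · simp [← hx x]
    · simp

/-- The catalyst consists of a position `k` and all but the `k`-th entry of a tuple. -/
theorem of_average_freq {X : Type u} [Fintype X] [DecidableEq X] {p p' : X → ℝ}
    (hp : IsProbDist p) {n d : ℕ} (σ : Fin d → Equiv.Perm (Fin (n + 1) → X)) (hd : 0 < d)
    (hσ : ∀ x, ∑ c, ∑ s, iid p (n + 1) s * freq x (σ c s) = d * p' x) :
    CatalyticallyConvertible p p' := by
  have hd' : (d : ℝ) ≠ 0 := by exact_mod_cast hd.ne'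
  have hn' : ((n + 1 : ℕ) : ℝ) ≠ 0 := by exact_mod_cast n.succ_ne_zero
  let r : (Fin (n + 1) → X) → ℝ := fun s => (∑ c, iid p (n + 1) ((σ c).symm s)) / d
  have hr0 : ∀ s, 0 ≤ r s := fun s =>
    div_nonneg (Finset.sum_nonneg fun c _ => iid_nonneg hp _ _) d.cast_nonneg
  have hr1 : ∑ s, r s = 1 := by
    simp only [r, ← Finset.sum_div]
    rw [Finset.sum_comm]
    simp only [fun c => Equiv.sum_comp (σ c).symm (iid p (n + 1)), sum_iid hp]
    simp [hd']
  have hrd : ∀ s, ∑ c, iid p (n + 1) ((σ c).symm s) = d * r s := by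
    intro s
    simp only [r]
    field_simp
  have hrfreq : ∀ x, ∑ s, r s * freq x s = p' x := by
    intro x
    refine mul_left_cancel₀ hd' ?_
    rw [← hσ, Finset.mul_sum]
    simp only [← mul_assoc, ← hrd, Finset.sum_mul]
    rw [Finset.sum_comm]
    refine Finset.sum_congr rfl fun c _ => ?_
    rw [← Equiv.sum_comp (σ c)]
    simp
  let q : Fin (n + 1) × (Fin n → X) → ℝ := fun z => hybridRest p r z.1 z.2 / (n + 1 : ℕ)
  let E : X × (Fin (n + 1) × (Fin n → X)) ≃ Fin (n + 1) × (Fin (n + 1) → X) :=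
    { toFun := fun a => (a.2.1, a.2.1.insertNth (α := fun _ => X) a.1 a.2.2)
      invFun := fun b => (b.2 b.1, b.1, b.1.removeNth b.2)
      left_inv := fun a => by simp
      right_inv := fun b => by simp }
  let step : Fin d → Equiv.Perm (Fin (n + 1) × (Fin (n + 1) → X)) := fun c =>
    Equiv.prodShear (finRotate (n + 1)) fun k => if k = Fin.last n then σ c else Equiv.refl _
  have hE : ∀ b, p (E.symm b).1 * q (E.symm b).2 = hybrid p r (b.1 + 1) b.2 / (n + 1 : ℕ) := by
    rintro ⟨k, s⟩
    have h := hybrid_succ_insertNth p r k (s k) (k.removeNth s)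
    rw [Fin.insertNth_self_removeNth] at h
    simp only [E, q, h, Equiv.coe_fn_symm_mk]
    ring
  have hstep : ∀ k s, ∑ c, p (E.symm ((step c).symm (k, s))).1 *
      q (E.symm ((step c).symm (k, s))).2 = d * (hybrid p r k s / (n + 1 : ℕ)) := by
    intro k s
    simp only [hE]
    rw [← Finset.sum_div, ← mul_div_assoc]
    congr 1
    refine Fin.cases ?_ (fun j => ?_) k
    · have h0 : (finRotate (n + 1)).symm 0 = Fin.last n := by
        rw [Equiv.symm_apply_eq, finRotate_last]
      simp only [step, Equiv.prodShear_symm_apply, h0, if_true, Fin.val_last, Fin.val_zero,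
        hybrid_zero, hybrid_length p hr1, hrd]
    · have h0 : (finRotate (n + 1)).symm j.succ = j.castSucc := by
        rw [Equiv.symm_apply_eq, finRotate_apply, Fin.coeSucc_eq_succ]
      simp [step, h0, Fin.castSucc_ne_last]
  have hEapp : ∀ x k w, E (x, k, w) = (k, k.insertNth (α := fun _ => X) x w) := fun _ _ _ => rfl
  refine ⟨_, inferInstance, d, q, fun c => (E.trans (step c)).trans E.symm, hd,
    ⟨fun z => div_nonneg (hybridRest_nonneg hp hr0 _ _) (Nat.cast_nonneg _), ?_⟩, ?_, fun x => ?_⟩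
  · simp only [q]
    rw [Fintype.sum_prod_type]
    simp only [← Finset.sum_div, sum_hybridRest hp, hr1]
    rw [Finset.sum_const, Finset.card_univ, Fintype.card_fin, nsmul_eq_mul, mul_one,
      div_self hn']
  · rintro ⟨k, w⟩
    simp only [Equiv.symm_trans_apply, Equiv.symm_symm, hEapp]
    rw [Finset.sum_comm]
    simp only [hstep, ← Finset.mul_sum, ← Finset.sum_div, sum_hybrid_insertNth, q]
  · simp only [Equiv.symm_trans_apply, Equiv.symm_symm]
    rw [Finset.sum_comm, Fintype.sum_prod_type]
    simp only [hEapp, hstep, ← Finset.mul_sum, ← Finset.sum_div, sum_hybrid_insertNth_rest hp]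
    rw [← hrfreq, Finset.sum_comm]
    simp only [freq, ← Finset.mul_sum, mul_div_assoc, Finset.sum_div]

/-- The control register is split into two uniform registers whose sum is the control, so that
each of them alone is independent of everything else. -/
theorem exists_perm {X : Type u} [Fintype X] {p p' : X → ℝ} (h : CatalyticallyConvertible p p') :
    ∃ (k d : ℕ), 0 < d ∧
      ∃ q : Fin k → ℝ, IsProbDist q ∧
        ∃ P : Equiv.Perm (X × Fin d × Fin k),
          (∀ z : Fin k,
            ∑ x : X, ∑ y : Fin d,
              (fun s : X × Fin d × Fin k => p s.1 * (d : ℝ)⁻¹ * q s.2.2) (P.symm (x, y, z))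
              = q z) ∧
          (∀ (x : X) (y : Fin d),
            ∑ z : Fin k,
              (fun s : X × Fin d × Fin k => p s.1 * (d : ℝ)⁻¹ * q s.2.2) (P.symm (x, y, z))
              = p' x * (d : ℝ)⁻¹) := by
  obtain ⟨Z, _, d, q, π, hd, hq, hz, hx⟩ := h
  have hd' : (d : ℝ) ≠ 0 := by exact_mod_cast hd.ne'
  have : NeZero d := ⟨hd.ne'⟩
  let e := Fintype.equivFin (Z × Fin d)
  let Q : Equiv.Perm (X × Fin d × (Z × Fin d)) :=
    { toFun := fun a => ((π (a.2.1 + a.2.2.2) (a.1, a.2.2.1)).1, a.2.1,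
        (π (a.2.1 + a.2.2.2) (a.1, a.2.2.1)).2, a.2.2.2)
      invFun := fun a => (((π (a.2.1 + a.2.2.2)).symm (a.1, a.2.2.1)).1, a.2.1,
        ((π (a.2.1 + a.2.2.2)).symm (a.1, a.2.2.1)).2, a.2.2.2)
      left_inv := fun a => by simp
      right_inv := fun a => by simp }
  let T : X × Fin d × (Z × Fin d) ≃ X × Fin d × Fin (Fintype.card (Z × Fin d)) :=
    (Equiv.refl X).prodCongr ((Equiv.refl (Fin d)).prodCongr e)
  have hP : ∀ x y z y', p ((T.symm.trans (Q.trans T)).symm (x, y, e (z, y'))).1 * (d : ℝ)⁻¹ *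
      (q (e.symm ((T.symm.trans (Q.trans T)).symm (x, y, e (z, y'))).2.2).1 * (d : ℝ)⁻¹) =
      p ((π (y + y')).symm (x, z)).1 * q ((π (y + y')).symm (x, z)).2 * ((d : ℝ)⁻¹ * (d : ℝ)⁻¹) := by
    intro x y z y'
    simp [T, Q]
    ring
  refine ⟨_, d, hd, fun j => q (e.symm j).1 * (d : ℝ)⁻¹,
    ⟨fun j => mul_nonneg (hq.1 _) (by positivity), ?_⟩, T.symm.trans (Q.trans T), ?_, ?_⟩
  · rw [← Equiv.sum_comp e, Fintype.sum_prod_type]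
    simp only [Equiv.symm_apply_apply, Finset.sum_const, Finset.card_univ, Fintype.card_fin,
      nsmul_eq_mul, ← Finset.mul_sum, ← Finset.sum_mul, hq.2, one_mul, mul_inv_cancel₀ hd']
  · intro j
    obtain ⟨⟨z, y'⟩, rfl⟩ := e.surjective j
    simp only [hP, ← Finset.sum_mul]
    have hshift := Equiv.sum_comp (Equiv.addRight y') fun c =>
      ∑ x, p ((π c).symm (x, z)).1 * q ((π c).symm (x, z)).2
    simp only [Equiv.coe_addRight] at hshift
    rw [Finset.sum_comm, hshift, hz]
    simp only [Equiv.symm_apply_apply]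
    field_simp
  · intro x y
    rw [← Equiv.sum_comp e, Fintype.sum_prod_type]
    simp only [hP, ← Finset.sum_mul]
    have hshift := Equiv.sum_comp (Equiv.addLeft y) fun c =>
      ∑ z, p ((π c).symm (x, z)).1 * q ((π c).symm (x, z)).2
    simp only [Equiv.coe_addLeft] at hshift
    rw [Finset.sum_comm, hshift, hx]
    field_simp

end CatalyticallyConvertible

theorem exists_perm_map_support {X : Type*} [Finite X] {p p' : X → ℝ}
    (h : Nat.card {x // p x ≠ 0} ≤ Nat.card {x // p' x ≠ 0}) :
    ∃ g : Equiv.Perm X, ∀ x, p x ≠ 0 → p' (g x) ≠ 0 := by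
  classical
  have := Fintype.ofFinite X
  rw [Nat.card_eq_fintype_card, Nat.card_eq_fintype_card] at h
  obtain ⟨f⟩ := Function.Embedding.nonempty_of_card_le h
  let e := Equiv.ofInjective (fun x => (f x : X)) (Subtype.val_injective.comp f.injective)
  refine ⟨e.extendSubtype, fun x hx => ?_⟩
  rw [e.extendSubtype_apply_of_mem x hx]
  exact (f ⟨x, hx⟩).2

theorem sum_comp_sumElim_zero {X S W : Type*} [Fintype X] [Fintype S] [Fintype W] {p : X → ℝ}
    {a : S → ℝ} {e : X ≃ S ⊕ W} (hp : p = Sum.elim a 0 ∘ e) {φ : ℝ → ℝ} (hφ : φ 0 = 0) :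
    ∑ x, φ (p x) = ∑ y, φ (a y) := by
  rw [hp, ← Equiv.sum_comp e.symm]
  simp [hφ]

/-- classical weak solution, forward direction. For different rational
distributions `p, p'` on `X` with `H(p') > H(p)` and at least as many nonzero entries in
`p'`, there exist a distribution `q` on a finite space `Z = Fin k`, a uniform distribution
on a `d`-element space `Y = Fin d`, and a permutation `P` of `X × Y × Z` such that the
marginal of `P(p ⊗ u_d ⊗ q)` on `Z` is `q` and its marginal on `X × Y` is `p' ⊗ u_d`. -/
theorem stmt7 {X : Type*} [Fintype X] (p p' : X → ℝ)
    (hp : IsProbDist p) (hp' : IsProbDist p')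
    (hrat : ∀ x, ∃ r : ℚ, p x = (r : ℝ)) (hrat' : ∀ x, ∃ r : ℚ, p' x = (r : ℝ))
    (hne : p ≠ p')
    (hH : shannon p < shannon p')
    (hrank : Nat.card {x // p x ≠ 0} ≤ Nat.card {x // p' x ≠ 0}) :
    ∃ (k d : ℕ), 0 < d ∧
      ∃ q : Fin k → ℝ, IsProbDist q ∧
        ∃ P : Equiv.Perm (X × Fin d × Fin k),
          (∀ z : Fin k,
            ∑ x : X, ∑ y : Fin d,
              (fun s : X × Fin d × Fin k => p s.1 * (d : ℝ)⁻¹ * q s.2.2) (P.symm (x, y, z))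
              = q z) ∧
          (∀ (x : X) (y : Fin d),
            ∑ z : Fin k,
              (fun s : X × Fin d × Fin k => p s.1 * (d : ℝ)⁻¹ * q s.2.2) (P.symm (x, y, z))
              = p' x * (d : ℝ)⁻¹) := by
  classical
  obtain ⟨g, hg⟩ := exists_perm_map_support hrank
  let e := (Equiv.sumCompl fun x => p' x ≠ 0).symm
  let a : {x // p' x ≠ 0} → ℝ := fun y => p (g.symm y)
  let a' : {x // p' x ≠ 0} → ℝ := fun y => p' y
  have hpa : p = Sum.elim a 0 ∘ g.trans e := by
    ext x
    rw [Function.comp_apply, Equiv.trans_apply]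
    by_cases hx : p' (g x) ≠ 0
    · rw [show e (g x) = Sum.inl ⟨g x, hx⟩ from
        Equiv.sumCompl_symm_apply_of_pos (p := fun x => p' x ≠ 0) hx]
      simp [a]
    · rw [show e (g x) = Sum.inr ⟨g x, hx⟩ from
        Equiv.sumCompl_symm_apply_of_neg (p := fun x => p' x ≠ 0) hx]
      exact not_imp_comm.1 (hg x) hx
  have hpa' : p' = Sum.elim a' 0 ∘ e := by
    ext x
    rw [Function.comp_apply]
    by_cases hx : p' x ≠ 0
    · rw [show e x = Sum.inl ⟨x, hx⟩ from
        Equiv.sumCompl_symm_apply_of_pos (p := fun x => p' x ≠ 0) hx]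
      rfl
    · rw [show e x = Sum.inr ⟨x, hx⟩ from
        Equiv.sumCompl_symm_apply_of_neg (p := fun x => p' x ≠ 0) hx]
      exact not_not.1 hx
  have ha : IsProbDist a :=
    ⟨fun y => hp.1 _, (sum_comp_sumElim_zero hpa (φ := id) rfl).symm.trans hp.2⟩
  have ha' : IsProbDist a' :=
    ⟨fun y => hp'.1 _, (sum_comp_sumElim_zero hpa' (φ := id) rfl).symm.trans hp'.2⟩
  have hHa : shannon a < shannon a' := by
    have h1 : shannon p = shannon a := sum_comp_sumElim_zero hpa Real.negMulLog_zero
    have h2 : shannon p' = shannon a' := sum_comp_sumElim_zero hpa' Real.negMulLog_zero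
    rwa [← h1, ← h2]
  obtain ⟨n, d, σ, hd, hσ⟩ := exists_perms_average_freq_eq ha ha' (fun y => hrat _)
    (fun y => hrat' _) (fun y => lt_of_le_of_ne (hp'.1 _) y.2.symm) hHa
  have h := ((CatalyticallyConvertible.of_average_freq ha σ hd hσ).sumElim_zero
    (W := {x // ¬ p' x ≠ 0})).comp_equiv (g.trans e) e
  rw [← hpa, ← hpa'] at h
  exact h.exists_perm
end
end

section
/- Let ρ, ρ' be density matrices of the same finite dimension such that ρ majorizes ρ' (the decreasingly ordered eigenvalue vector of ρ majorizes that of ρ'). Then there exist orthonormal bases J and unitaries U, V such that ρ' = V (D_J[U ρ U†]) V†, where D_J is the dephasing channel in the basis J. Moreover, if J is chosen as an eigenbasis of ρ', then V can be taken to be the identity. -/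
open scoped Kronecker ComplexOrder
open Matrix

noncomputable section

/-- `ρ` is a density matrix: positive semidefinite with unit trace. -/
def IsDensityMatrix {ι : Type*} [Fintype ι] (ρ : Matrix ι ι ℂ) : Prop :=
  ρ.PosSemidef ∧ ρ.trace = 1

/-- Partial trace over the second tensor factor. -/
def ptrace2 {ι κ : Type*} [Fintype κ] (M : Matrix (ι × κ) (ι × κ) ℂ) : Matrix ι ι ℂ :=
  Matrix.of fun i j => ∑ k, M (i, k) (j, k)

/-- Partial trace over the first tensor factor. -/
def ptrace1 {ι κ : Type*} [Fintype ι] (M : Matrix (ι × κ) (ι × κ) ℂ) : Matrix κ κ ℂ :=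
  Matrix.of fun i j => ∑ k, M (k, i) (k, j)

/-- Dephasing (decoherence) channel in the fixed (standard) orthonormal basis `{|j⟩}`:
`D[σ] = ∑ j ⟨j|σ|j⟩ |j⟩⟨j|`. -/
def deph {ι : Type*} [DecidableEq ι] (M : Matrix ι ι ℂ) : Matrix ι ι ℂ :=
  Matrix.diagonal fun j => M j j

/-- The eigenvalue list of a matrix (junk value `0` if not Hermitian). -/
def eigs {ι : Type*} [Fintype ι] [DecidableEq ι] (ρ : Matrix ι ι ℂ) : ι → ℝ :=
  if h : ρ.IsHermitian then h.eigenvalues else 0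

/-- The spectrum of a matrix, as a multiset of real eigenvalues (with multiplicity). -/
def spectra {ι : Type*} [Fintype ι] [DecidableEq ι] (ρ : Matrix ι ι ℂ) : Multiset ℝ :=
  Finset.univ.val.map (eigs ρ)

/-- von Neumann entropy `S(ρ) = -tr(ρ log ρ)`, i.e. the Shannon entropy
of the eigenvalue list (natural logarithm). -/
def vN {ι : Type*} [Fintype ι] [DecidableEq ι] (ρ : Matrix ι ι ℂ) : ℝ :=
  ∑ i, Real.negMulLog (eigs ρ i)

/-- Maximally mixed state `𝟙_d = (1/d)·I_d`. -/
def mm (d : ℕ) : Matrix (Fin d) (Fin d) ℂ :=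
  (d : ℂ)⁻¹ • (1 : Matrix (Fin d) (Fin d) ℂ)

/-- The sum of the `k` largest entries of `a`, expressed as the supremum of sums over
subsets of cardinality `k`. -/
def kSum {ι : Type*} [Fintype ι] (a : ι → ℝ) (k : ℕ) : ℝ :=
  ⨆ s ∈ {s : Finset ι | s.card = k}, ∑ i ∈ s, a i

/-- `a` majorizes `b`: for every `k`, the sum of the `k` largest entries of `a` is at least
that of `b`, with equality of the total sums. -/
def Maj {ι : Type*} [Fintype ι] (a b : ι → ℝ) : Prop :=
  (∀ k : ℕ, kSum b k ≤ kSum a k) ∧ ∑ i, a i = ∑ i, b i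

/-- The real numbers that occur as diagonals of unitary conjugates of `M`. -/
def IsOrbitDiag {ι : Type*} [Fintype ι] [DecidableEq ι] (M : Matrix ι ι ℂ) (d : ι → ℝ) : Prop :=
  ∃ U ∈ Matrix.unitaryGroup ι ℂ, ∀ i, (U * M * Uᴴ) i i = (d i : ℂ)

/-- The rotation by the angle `θ` in the plane of the coordinates `i` and `j`. -/
def planeRotation {ι : Type*} [DecidableEq ι] (i j : ι) (θ : ℝ) : Matrix ι ι ℂ :=
  Matrix.of fun k =>
    if k = i then (Real.cos θ : ℂ) • Pi.single i 1 + (Real.sin θ : ℂ) • Pi.single j 1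
    else if k = j then (Real.cos θ : ℂ) • Pi.single j 1 - (Real.sin θ : ℂ) • Pi.single i 1
    else Pi.single k 1

section Rotation

variable {ι : Type*} [Fintype ι] [DecidableEq ι]

lemma planeRotation_mul_apply (i j : ι) (θ : ℝ) (M : Matrix ι ι ℂ) (k l : ι) :
    (planeRotation i j θ * M) k l =
      if k = i then Real.cos θ * M i l + Real.sin θ * M j l
      else if k = j then Real.cos θ * M j l - Real.sin θ * M i l else M k l := by
  simp only [Matrix.mul_apply, planeRotation, Matrix.of_apply]
  split_ifs <;>
    simp [add_mul, sub_mul, Finset.sum_add_distrib, Finset.sum_sub_distrib, Pi.single_apply]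

lemma mul_planeRotation_conjTranspose_apply (i j : ι) (θ : ℝ) (M : Matrix ι ι ℂ) (k l : ι) :
    (M * (planeRotation i j θ)ᴴ) k l =
      if l = i then Real.cos θ * M k i + Real.sin θ * M k j
      else if l = j then Real.cos θ * M k j - Real.sin θ * M k i else M k l := by
  have h : M * (planeRotation i j θ)ᴴ = (planeRotation i j θ * Mᴴ)ᴴ := by simp
  rw [h, Matrix.conjTranspose_apply, planeRotation_mul_apply]
  split_ifs <;> simp [-Complex.ofReal_cos, -Complex.ofReal_sin]

lemma planeRotation_mem_unitaryGroup {i j : ι} (hij : i ≠ j) (θ : ℝ) :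
    planeRotation i j θ ∈ Matrix.unitaryGroup ι ℂ := by
  have hcs : (Real.cos θ : ℂ) * Real.cos θ + Real.sin θ * Real.sin θ = 1 := by
    exact_mod_cast by nlinarith [Real.sin_sq_add_cos_sq θ]
  rw [Matrix.mem_unitaryGroup_iff, Matrix.star_eq_conjTranspose]
  ext k l
  rw [mul_planeRotation_conjTranspose_apply]
  have h := fun k l => planeRotation_mul_apply i j θ 1 k l
  simp only [mul_one] at h
  simp only [h, Matrix.one_apply]
  grind

/-- A Givens rotation turns a diagonal entry into any prescribed value between it and another one,
keeping their sum and the remaining diagonal entries. -/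
lemma exists_planeRotation_diag {M : Matrix ι ι ℂ} (hM : M.IsHermitian) {i j : ι} (hij : i ≠ j)
    {x : ℝ} (hx : x ∈ Set.uIcc (M i i).re (M j j).re) :
    ∃ R ∈ Matrix.unitaryGroup ι ℂ, (R * M * Rᴴ) i i = x ∧
      (R * M * Rᴴ) j j = M i i + M j j - x ∧
      ∀ k, k ≠ i → k ≠ j → (R * M * Rᴴ) k k = M k k := by
  have hdiag : ∀ k, M k k = ((M k k).re : ℂ) := fun k =>
    (Complex.conj_eq_iff_re.1 (hM.apply k k)).symm
  have hsum : M i j + M j i = ((2 * (M i j).re : ℝ) : ℂ) := by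
    rw [← hM.apply j i, ← Complex.add_conj]
    rfl
  let f : ℝ → ℝ := fun θ => Real.cos θ ^ 2 * (M i i).re
    + Real.cos θ * Real.sin θ * (2 * (M i j).re) + Real.sin θ ^ 2 * (M j j).re
  have hf : ContinuousOn f (Set.uIcc 0 (Real.pi / 2)) := by fun_prop
  obtain ⟨θ, -, hθ⟩ := intermediate_value_uIcc hf (show x ∈ _ by simpa [f] using hx)
  have hcs : (Real.cos θ : ℂ) ^ 2 + (Real.sin θ : ℂ) ^ 2 = 1 := by
    exact_mod_cast by nlinarith [Real.sin_sq_add_cos_sq θ]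
  have hx' : (Real.cos θ : ℂ) ^ 2 * M i i + Real.cos θ * Real.sin θ * (M i j + M j i)
      + Real.sin θ ^ 2 * M j j = x := by
    rw [hsum, hdiag i, hdiag j, ← hθ]; simp only [f]; push_cast; ring
  refine ⟨planeRotation i j θ, planeRotation_mem_unitaryGroup hij θ, ?_, ?_, fun k hki hkj => ?_⟩
  · rw [← hx', mul_planeRotation_conjTranspose_apply]
    simp only [planeRotation_mul_apply, if_true]
    ring
  · rw [← hx', mul_planeRotation_conjTranspose_apply]
    simp only [planeRotation_mul_apply, if_true, hij.symm, if_false]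
    linear_combination (M i i + M j j) * hcs
  · rw [mul_planeRotation_conjTranspose_apply]
    simp [planeRotation_mul_apply, hki, hkj]

/-- Diagonals of a unitary orbit are closed under T-transforms. -/
lemma IsOrbitDiag.of_transfer {M : Matrix ι ι ℂ} (hM : M.IsHermitian) {a c : ι → ℝ}
    (ha : IsOrbitDiag M a) {i j : ι} (hij : i ≠ j) (hi : c i ∈ Set.uIcc (a i) (a j))
    (hsum : c i + c j = a i + a j) (hc : ∀ k, k ≠ i → k ≠ j → c k = a k) : IsOrbitDiag M c := by
  obtain ⟨U, hU, hUa⟩ := ha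
  obtain ⟨R, hR, h1, h2, h3⟩ := exists_planeRotation_diag
    (Matrix.isHermitian_mul_mul_conjTranspose U hM) hij (x := c i) (by simpa [hUa] using hi)
  refine ⟨R * U, mul_mem hR hU, fun k => ?_⟩
  rw [Matrix.conjTranspose_mul, show R * U * M * (Uᴴ * Rᴴ) = R * (U * M * Uᴴ) * Rᴴ by
    simp only [Matrix.mul_assoc]]
  by_cases hki : k = i
  · rw [hki, h1]
  by_cases hkj : k = j
  · rw [hkj, h2, hUa, hUa, sub_eq_iff_eq_add]
    exact_mod_cast by linarith
  · rw [h3 k hki hkj, hUa, hc k hki hkj]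

lemma IsOrbitDiag.comp_perm {M : Matrix ι ι ℂ} (hM : M.IsHermitian) {a : ι → ℝ}
    (ha : IsOrbitDiag M a) (σ : Equiv.Perm ι) : IsOrbitDiag M (a ∘ σ) := by
  induction σ using Equiv.Perm.swap_induction_on generalizing a with
  | one => simpa using ha
  | swap_mul f x y hxy ih =>
    have h : IsOrbitDiag M (a ∘ Equiv.swap x y) :=
      ha.of_transfer hM hxy (by simp) (by simp [add_comm]) fun k hx hy => by
        simp [Equiv.swap_apply_of_ne_of_ne hx hy]
    exact ih h

lemma Matrix.IsHermitian.isOrbitDiag_eigenvalues {M : Matrix ι ι ℂ} (hM : M.IsHermitian) :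
    IsOrbitDiag M hM.eigenvalues := by
  refine ⟨star (hM.eigenvectorUnitary : Matrix ι ι ℂ), Unitary.star_mem hM.eigenvectorUnitary.2,
    fun i => ?_⟩
  have h := congr_fun₂ hM.conjStarAlgAut_star_eigenvectorUnitary i i
  rw [Unitary.conjStarAlgAut_star_apply] at h
  simpa [Matrix.star_eq_conjTranspose] using h

end Rotation

/-- If `b` is antitone and its partial sums are dominated by those of `a`, with equal totals,
then `b` is obtained from `a` by T-transforms, so it is a diagonal whenever `a` is. -/
lemma IsOrbitDiag.of_sum_Iic_le {ι : Type*} [Fintype ι] [LinearOrder ι] [LocallyFiniteOrderBot ι]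
    {M : Matrix ι ι ℂ} (hM : M.IsHermitian) {a b : ι → ℝ} (ha : IsOrbitDiag M a)
    (hb : Antitone b) (hle : ∀ m, ∑ i ∈ Finset.Iic m, b i ≤ ∑ i ∈ Finset.Iic m, a i)
    (hsum : ∑ i, a i = ∑ i, b i) : IsOrbitDiag M b := by
  induction hN : (Finset.univ.filter fun i => a i ≠ b i).card using Nat.strong_induction_on
    generalizing a with
  | _ N ih =>
  by_cases hab : a = b
  · exact hab ▸ ha
  have hlt : ∃ k, a k < b k := by
    by_contra! h
    exact hab (funext fun i =>
      ((Finset.sum_eq_sum_iff_of_le fun i _ => h i).1 hsum.symm i (Finset.mem_univ i)).symm)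
  obtain ⟨k, hk, hmin⟩ : ∃ k, a k < b k ∧ ∀ i < k, b i ≤ a i := by
    obtain ⟨k, hk⟩ := (Finset.univ.filter fun k => a k < b k).exists_minimal (by
      obtain ⟨k, hk⟩ := hlt
      exact ⟨k, by simpa using hk⟩)
    refine ⟨k, by simpa using hk.1, fun i hi => ?_⟩
    by_contra! h
    exact (hk.2 (by simpa using h) hi.le).not_gt hi
  obtain ⟨j, hjk, hj⟩ : ∃ j < k, b j < a j := by
    by_contra! h
    refine (hle k).not_gt (Finset.sum_lt_sum (fun i hi => ?_) ⟨k, by simp, hk⟩)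
    rcases (Finset.mem_Iic.1 hi).lt_or_eq with h' | h'
    · exact h i h'
    · exact h' ▸ hk.le
  have hbjk := hb hjk.le
  obtain ⟨δ, hδ0, hδj, hδk, hδ⟩ : ∃ δ, 0 < δ ∧ δ ≤ a j - b j ∧ δ ≤ b k - a k ∧
      (δ = a j - b j ∨ δ = b k - a k) :=
    ⟨min (a j - b j) (b k - a k), lt_min (by linarith) (by linarith), min_le_left _ _,
      min_le_right _ _, min_choice _ _⟩
  let c : ι → ℝ := a + (Pi.single k δ - Pi.single j δ)
  have hcj : c j = a j - δ := by simp [c, hjk.ne, sub_eq_add_neg]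
  have hck : c k = a k + δ := by simp [c, hjk.ne']
  have hc : ∀ i, i ≠ j → i ≠ k → c i = a i := fun i h1 h2 => by simp [c, h1, h2]
  have hcsum : ∀ s : Finset ι, ∑ i ∈ s, c i =
      ∑ i ∈ s, a i + ((if k ∈ s then δ else 0) - if j ∈ s then δ else 0) := fun s => by
    simp [c, Finset.sum_add_distrib, Finset.sum_sub_distrib, Finset.sum_pi_single']
  refine ih _ ?_ (a := c) (ha.of_transfer hM hjk.ne ?_ (by linarith) hc) (fun m => ?_) ?_ rfl
  · rw [← hN]
    refine Finset.card_lt_card ((Finset.ssubset_iff_of_subset fun i => ?_).2 ?_)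
    · simp only [Finset.mem_filter_univ]
      intro hi h
      have hij : i ≠ j := by rintro rfl; exact hj.ne' h
      have hik : i ≠ k := by rintro rfl; exact hk.ne h
      exact hi (hc i hij hik ▸ h)
    · rcases hδ with h | h
      · exact ⟨j, by simpa using hj.ne', by simp [hcj, h]⟩
      · exact ⟨k, by simpa using hk.ne, by simp [hck, h]⟩
  · rw [hcj, Set.uIcc_of_ge (by linarith)]
    constructor <;> linarith
  · rw [hcsum]
    simp only [Finset.mem_Iic]
    have := hle m
    by_cases hkm : k ≤ m
    · simpa [hkm, hjk.le.trans hkm] using this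
    by_cases hjm : j ≤ m
    · have h : ∀ i ∈ Finset.Iic m, 0 ≤ a i - b i := fun i hi =>
        sub_nonneg.2 (hmin i ((Finset.mem_Iic.1 hi).trans_lt (not_le.1 hkm)))
      have := Finset.single_le_sum h (Finset.mem_Iic.2 hjm)
      rw [Finset.sum_sub_distrib] at this
      simp only [hkm, hjm, if_true, if_false]
      linarith
    · simpa [hkm, hjm] using this
  · simp [hcsum, hsum]

/-- For antitone `a`, the first entries have the largest sum among subsets of the same size. -/
lemma Antitone.sum_le_sum_Iic {ι : Type*} [LinearOrder ι] [LocallyFiniteOrderBot ι] {a : ι → ℝ}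
    (ha : Antitone a) (m : ι) {t : Finset ι} (ht : t.card = (Finset.Iic m).card) :
    ∑ i ∈ t, a i ≤ ∑ i ∈ Finset.Iic m, a i := by
  rw [← sub_nonpos, ← Finset.sum_sdiff_sub_sum_sdiff, sub_nonpos]
  calc ∑ i ∈ t \ Finset.Iic m, a i ≤ (t \ Finset.Iic m).card • a m :=
        Finset.sum_le_card_nsmul _ _ _ fun i hi => ha (by simp at hi; exact hi.2.le)
    _ = (Finset.Iic m \ t).card • a m := by rw [Finset.card_sdiff_comm ht]
    _ ≤ ∑ i ∈ Finset.Iic m \ t, a i :=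
        Finset.card_nsmul_le_sum _ _ _ fun i hi => ha (by simp at hi; exact hi.1)

section KSum

variable {ι : Type*} [Fintype ι] {a : ι → ℝ}

lemma sum_le_kSum (s : Finset ι) : ∑ i ∈ s, a i ≤ kSum a s.card := by
  have h : ∑ i ∈ s, a i = ⨆ _ : s ∈ {t : Finset ι | t.card = s.card}, ∑ i ∈ s, a i := by simp
  rw [h]
  exact le_ciSup (f := fun u : Finset ι => ⨆ _ : u ∈ {t : Finset ι | t.card = s.card},
    ∑ i ∈ u, a i) (Set.finite_range _).bddAbove s

lemma kSum_le {k : ℕ} {x : ℝ} (hx : 0 ≤ x)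
    (h : ∀ s : Finset ι, s.card = k → ∑ i ∈ s, a i ≤ x) : kSum a k ≤ x :=
  Real.iSup_le (fun s => Real.iSup_le (h s) hx) hx

end KSum

/-- Horn's theorem for a nonnegative spectrum. -/
lemma IsOrbitDiag.of_maj {n : ℕ} {M : Matrix (Fin n) (Fin n) ℂ} (hM : M.IsHermitian)
    {a b : Fin n → ℝ} (ha : IsOrbitDiag M a) (ha0 : 0 ≤ a) (h : Maj a b) : IsOrbitDiag M b := by
  obtain ⟨σ, hσ⟩ : ∃ σ : Equiv.Perm (Fin n), Antitone (a ∘ σ) :=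
    ⟨_, fun i j hij => neg_le_neg_iff.1 (Tuple.monotone_sort (-a) hij)⟩
  obtain ⟨τ, hτ⟩ : ∃ τ : Equiv.Perm (Fin n), Antitone (b ∘ τ) :=
    ⟨_, fun i j hij => neg_le_neg_iff.1 (Tuple.monotone_sort (-b) hij)⟩
  have key : IsOrbitDiag M (b ∘ τ) := by
    refine (ha.comp_perm hM σ).of_sum_Iic_le hM hτ (fun m => ?_) ?_
    · calc ∑ i ∈ Finset.Iic m, (b ∘ τ) i = ∑ i ∈ (Finset.Iic m).map τ.toEmbedding, b i := by simp
        _ ≤ kSum b (Finset.Iic m).card := by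
          simpa only [Finset.card_map] using sum_le_kSum (a := b) ((Finset.Iic m).map τ.toEmbedding)
        _ ≤ kSum a (Finset.Iic m).card := h.1 _
        _ ≤ ∑ i ∈ Finset.Iic m, (a ∘ σ) i := by
          refine kSum_le (Finset.sum_nonneg fun i _ => ha0 _) fun s hs => ?_
          have := hσ.sum_le_sum_Iic m (t := s.map σ.symm.toEmbedding) (by simpa using hs)
          simpa using this
    · simpa [Equiv.sum_comp] using h.2
  simpa [Function.comp_assoc] using key.comp_perm hM τ.symm


/-- Two families with the same multiset of values differ by a permutation of the indices. -/
lemma exists_perm_of_map_univ_eq {ι α : Type*} [Fintype ι] {f g : ι → α}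
    (h : Multiset.map f Finset.univ.val = Multiset.map g Finset.univ.val) :
    ∃ σ : Equiv.Perm ι, f = g ∘ σ := by
  classical
  have hcard : ∀ y, Fintype.card {x // f x = y} = Fintype.card {x // g x = y} := fun y => by
    have := congrArg (Multiset.count y) h
    simp only [Multiset.count_map, eq_comm (a := y)] at this
    rw [Fintype.card_subtype, Fintype.card_subtype]
    exact this
  let e := fun y => Fintype.equivOfCardEq (hcard y)
  refine ⟨(Equiv.sigmaFiberEquiv f).symm.trans
    ((Equiv.sigmaCongrRight e).trans (Equiv.sigmaFiberEquiv g)), funext fun x => ?_⟩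
  exact (e (f x) ⟨x, rfl⟩).2.symm

/-- The diagonal entries of a diagonalization of `M` are its eigenvalues up to order. -/
lemma Matrix.IsHermitian.exists_perm_eigenvalues_of_isDiag {ι : Type*} [Fintype ι] [DecidableEq ι]
    {M W : Matrix ι ι ℂ} (hM : M.IsHermitian) (hW : W ∈ Matrix.unitaryGroup ι ℂ)
    (hd : (Wᴴ * M * W).IsDiag) :
    ∃ σ : Equiv.Perm ι, Wᴴ * M * W = Matrix.diagonal fun i => (hM.eigenvalues (σ i) : ℂ) := by
  have hWW : W * Wᴴ = 1 := Matrix.mem_unitaryGroup_iff.1 hW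
  have hchar : (Wᴴ * M * W).charpoly = M.charpoly := by
    rw [Matrix.charpoly_mul_comm, ← Matrix.mul_assoc, hWW, Matrix.one_mul]
  have hroots := hM.roots_charpoly_eq_eigenvalues
  rw [← hchar, ← hd.diagonal_diag, Matrix.charpoly_diagonal, Polynomial.roots_prod _ _
    (Finset.prod_ne_zero_iff.2 fun i _ => Polynomial.X_sub_C_ne_zero _)] at hroots
  simp only [Polynomial.roots_X_sub_C, Multiset.bind_singleton] at hroots
  obtain ⟨σ, hσ⟩ := exists_perm_of_map_univ_eq hroots
  refine ⟨σ, ?_⟩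
  rw [← hd.diagonal_diag, hσ]
  rfl

/-- If `ρ` majorizes `ρ'`, then `ρ'` is the dephasing of a unitary conjugate of `ρ` in any
eigenbasis `W` of the former. -/
lemma exists_unitary_eq_deph {n : ℕ} {ρ ρ' W : Matrix (Fin n) (Fin n) ℂ} (hρ : ρ.PosSemidef)
    (hρ' : ρ'.IsHermitian) (hmaj : Maj (eigs ρ) (eigs ρ'))
    (hW : W ∈ Matrix.unitaryGroup (Fin n) ℂ) (hd : (Wᴴ * ρ' * W).IsDiag) :
    ∃ U ∈ Matrix.unitaryGroup (Fin n) ℂ, ρ' = W * deph (Wᴴ * (U * ρ * Uᴴ) * W) * Wᴴ := by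
  have hWW : W * Wᴴ = 1 := Matrix.mem_unitaryGroup_iff.1 hW
  have hWW' : Wᴴ * W = 1 := Matrix.mem_unitaryGroup_iff'.1 hW
  simp only [eigs, hρ.isHermitian, hρ', dif_pos] at hmaj
  obtain ⟨σ, hσ⟩ := hρ'.exists_perm_eigenvalues_of_isDiag hW hd
  obtain ⟨U, hU, hUd⟩ := (hρ.isHermitian.isOrbitDiag_eigenvalues.of_maj hρ.isHermitian
    hρ.eigenvalues_nonneg hmaj).comp_perm hρ.isHermitian σ
  refine ⟨W * U, mul_mem hW hU, ?_⟩
  have h : Wᴴ * (W * U * ρ * (W * U)ᴴ) * W = U * ρ * Uᴴ := by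
    rw [Matrix.conjTranspose_mul, show Wᴴ * (W * U * ρ * (Uᴴ * Wᴴ)) * W =
      (Wᴴ * W) * (U * ρ * Uᴴ) * (Wᴴ * W) by simp only [Matrix.mul_assoc], hWW', Matrix.one_mul,
      Matrix.mul_one]
  have hdeph : deph (U * ρ * Uᴴ) = Wᴴ * ρ' * W := by
    rw [hσ, deph]
    simp only [hUd, Function.comp_apply]
  rw [h, hdeph, show W * (Wᴴ * ρ' * W) * Wᴴ = (W * Wᴴ) * ρ' * (W * Wᴴ) by
    simp only [Matrix.mul_assoc], hWW, Matrix.one_mul, Matrix.mul_one]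

/-- Schur–Horn consequence. If `ρ` majorizes `ρ'`, then there are an
orthonormal basis `J` (the columns of a unitary `W`, so that dephasing in `J` is
`σ ↦ W·deph(Wᴴ σ W)·Wᴴ`) and unitaries `U, V` with `ρ' = V (D_J[U ρ U†]) V†`.
Moreover, whenever `J` (i.e. `W`) is an eigenbasis of `ρ'`, `V` may be taken to be
the identity. -/
theorem stmt11 {n : ℕ} (ρ ρ' : Matrix (Fin n) (Fin n) ℂ)
    (hρ : IsDensityMatrix ρ) (hρ' : IsDensityMatrix ρ')
    (hmaj : Maj (eigs ρ) (eigs ρ')) :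
    (∃ W ∈ Matrix.unitaryGroup (Fin n) ℂ, ∃ U ∈ Matrix.unitaryGroup (Fin n) ℂ,
      ∃ V ∈ Matrix.unitaryGroup (Fin n) ℂ,
        ρ' = V * (W * deph (Wᴴ * (U * ρ * Uᴴ) * W) * Wᴴ) * Vᴴ) ∧
    (∀ W ∈ Matrix.unitaryGroup (Fin n) ℂ, (Wᴴ * ρ' * W).IsDiag →
      ∃ U ∈ Matrix.unitaryGroup (Fin n) ℂ,
        ρ' = W * deph (Wᴴ * (U * ρ * Uᴴ) * W) * Wᴴ) := by
  have key := fun W (hW : W ∈ Matrix.unitaryGroup (Fin n) ℂ) =>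
    exists_unitary_eq_deph (W := W) hρ.1 hρ'.1.isHermitian hmaj hW
  refine ⟨?_, key⟩
  have hH := hρ'.1.isHermitian
  have h := hH.conjStarAlgAut_star_eigenvectorUnitary
  rw [Unitary.conjStarAlgAut_star_apply, Matrix.star_eq_conjTranspose] at h
  obtain ⟨U, hU, hUρ⟩ := key _ hH.eigenvectorUnitary.2 (h ▸ Matrix.isDiag_diagonal _)
  exact ⟨_, hH.eigenvectorUnitary.2, U, hU, 1, one_mem _, by simpa using hUρ⟩
end
end
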